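/- For every integer n ≥ 4, the integral over ℝ^{n−3} of the function (s₁,…,s_{n−3}) ↦ 1 / (∏_{i=1}^{n−3}(1 + e^{−sᵢ}) · (1 + ∑_{j=1}^{n−3} e^{s₁+⋯+s_j})) is at most ((n−4)!!/(n−3)!!)·π^{n−4} if n is even, and at most ((n−4)!!/(2·(n−3)!!))·π^{n−3} if n is odd. -/

import Mathlib

open MeasureTheory Real

/-- Extend a tuple `s : Fin m → ℝ` to a function on `ℕ` (0-indexed), by `0` outside. -/
noncomputable def padR (m : ℕ) (s : Fin m → ℝ) (i : ℕ) : ℝ :=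
  if h : i < m then s ⟨i, h⟩ else 0

/-- The self-dual kernel `t ↦ 1 / (2 cosh (t / 2))`. -/
noncomputable def halfSech (t : ℝ) : ℝ := (2 * Real.cosh (t / 2))⁻¹

lemma halfSech_pos (t : ℝ) : 0 < halfSech t :=
  inv_pos.2 (mul_pos two_pos (Real.cosh_pos _))

lemma continuous_halfSech : Continuous halfSech :=
  Continuous.inv₀ (by fun_prop) fun t => (mul_pos two_pos (Real.cosh_pos (t / 2))).ne'

lemma halfSech_le_one (t : ℝ) : halfSech t ≤ 1 :=
  inv_le_one_of_one_le₀ (by linarith [Real.one_le_cosh (t / 2)])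

lemma halfSech_mul_exp (t : ℝ) : halfSech t * Real.exp (t / 2) = (1 + Real.exp (-t))⁻¹ := by
  have h : Real.exp (-t) = Real.exp (-(t / 2)) * Real.exp (-(t / 2)) := by
    rw [← Real.exp_add]; ring_nf
  have h1 : Real.exp (t / 2) * Real.exp (-(t / 2)) = 1 := by
    rw [← Real.exp_add]; simp
  have h2 := Real.exp_pos (t / 2)
  have h3 := Real.exp_pos (-(t / 2))
  rw [halfSech, Real.cosh_eq, h]
  field_simp
  linear_combination Real.exp (-(t / 2)) * h1

lemma halfSech_neg (t : ℝ) : halfSech (-t) = halfSech t := by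
  simp [halfSech, neg_div]

lemma sigmoid_mul_one_sub (t : ℝ) :
    Real.sigmoid t * (1 - Real.sigmoid t) = halfSech t ^ 2 := by
  rw [← Real.sigmoid_neg, Real.sigmoid_def, Real.sigmoid_def, ← halfSech_mul_exp,
    ← halfSech_mul_exp, halfSech_neg, sq]
  have : Real.exp (t / 2) * Real.exp (-t / 2) = 1 := by
    rw [← Real.exp_add]; simp [neg_div]
  linear_combination (halfSech t * halfSech t) * this

lemma log_sigmoid_sub (t : ℝ) :
    Real.log (Real.sigmoid t) - Real.log (1 - Real.sigmoid t) = t := by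
  rw [← Real.sigmoid_neg, ← Real.sigmoid_mul_rexp_neg,
    Real.log_mul (Real.sigmoid_pos t).ne' (Real.exp_pos _).ne', Real.log_exp]
  ring

lemma betaIntegral_one_sub {s : ℂ} (h0 : 0 < s.re) (h1 : s.re < 1) :
    Complex.betaIntegral s (1 - s) = π / Complex.sin (π * s) := by
  have h := Complex.Gamma_mul_Gamma_eq_betaIntegral (s := s) (t := 1 - s) h0 (by simpa using h1)
  rw [Complex.Gamma_mul_Gamma_one_sub] at h
  simpa using h.symm

lemma betaIntegral_eq_integral_sigmoid (u v : ℂ) :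
    Complex.betaIntegral u v =
      ∫ t : ℝ, ((Real.sigmoid t * (1 - Real.sigmoid t) : ℝ) : ℂ) *
        ((Real.sigmoid t : ℂ) ^ (u - 1) * (1 - (Real.sigmoid t : ℂ)) ^ (v - 1)) := by
  rw [Complex.betaIntegral, intervalIntegral.integral_of_le zero_le_one,
    integral_Ioc_eq_integral_Ioo, ← Real.range_sigmoid, ← Set.image_univ,
    integral_image_eq_integral_abs_deriv_smul MeasurableSet.univ
      (fun t _ => (hasDerivAt_sigmoid t).hasDerivWithinAt) Real.sigmoid_injective.injOn,
    setIntegral_univ]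
  refine integral_congr_ae (ae_of_all _ fun t => ?_)
  have : 0 ≤ Real.sigmoid t * (1 - Real.sigmoid t) := by
    rw [sigmoid_mul_one_sub]; positivity
  simp only [abs_of_nonneg this, Complex.real_smul]

lemma sigmoid_cpow_mul (t : ℝ) (z : ℂ) :
    ((Real.sigmoid t * (1 - Real.sigmoid t) : ℝ) : ℂ) *
        ((Real.sigmoid t : ℂ) ^ (1 / 2 + z - 1) *
          (1 - (Real.sigmoid t : ℂ)) ^ (1 - (1 / 2 + z) - 1)) =
      Complex.exp (t * z) * halfSech t := by
  have h0 := Real.sigmoid_pos t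
  have h1 : 0 < 1 - Real.sigmoid t := sub_pos.2 (Real.sigmoid_lt_one t)
  have hg := halfSech_pos t
  have hlog : Real.log (Real.sigmoid t) + Real.log (1 - Real.sigmoid t) =
      2 * Real.log (halfSech t) := by
    rw [← Real.log_mul h0.ne' h1.ne', sigmoid_mul_one_sub, Real.log_pow]; norm_num
  have hsub := log_sigmoid_sub t
  have hexp : ((halfSech t : ℝ) : ℂ) = Complex.exp (Real.log (halfSech t) : ℝ) := by
    rw [← Complex.ofReal_exp, Real.exp_log hg]
  rw [sigmoid_mul_one_sub, show (1 : ℂ) - (Real.sigmoid t : ℂ) = ((1 - Real.sigmoid t : ℝ) : ℂ) by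
    push_cast; rfl, Complex.cpow_def_of_ne_zero (by exact_mod_cast h0.ne'),
    Complex.cpow_def_of_ne_zero (by exact_mod_cast h1.ne'), ← Complex.ofReal_log h0.le,
    ← Complex.ofReal_log h1.le, Complex.ofReal_pow, hexp, ← Complex.exp_nat_mul,
    ← Complex.exp_add, ← Complex.exp_add, ← Complex.exp_add]
  congr 1
  have hlog' : ((Real.log (Real.sigmoid t) : ℝ) : ℂ) + (Real.log (1 - Real.sigmoid t) : ℝ) =
      2 * (Real.log (halfSech t) : ℝ) := by exact_mod_cast hlog
  have hsub' : ((Real.log (Real.sigmoid t) : ℝ) : ℂ) - (Real.log (1 - Real.sigmoid t) : ℝ) = t := by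
    exact_mod_cast hsub
  push_cast
  linear_combination (-1 / 2 : ℂ) * hlog' + z * hsub'

/-- Up to normalization, `halfSech` is its own Fourier transform. -/
lemma integral_exp_mul_halfSech (x : ℝ) :
    ∫ t : ℝ, Complex.exp (t * (x / (2 * π) * Complex.I)) * halfSech t = 2 * π * halfSech x := by
  have hπ : (π : ℂ) ≠ 0 := by exact_mod_cast Real.pi_ne_zero
  set z : ℂ := x / (2 * π) * Complex.I with hz
  have hre : z.re = 0 := by
    rw [hz, show (x : ℂ) / (2 * π) = ((x / (2 * π) : ℝ) : ℂ) by push_cast; rfl]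
    exact Complex.re_ofReal_mul _ _ |>.trans (by simp)
  simp_rw [← sigmoid_cpow_mul]
  rw [← betaIntegral_eq_integral_sigmoid, betaIntegral_one_sub (by simp [hre])
    (by simp only [Complex.add_re, hre]; norm_num)]
  have harg : (π : ℂ) * (1 / 2 + z) = x / 2 * Complex.I + π / 2 := by
    rw [hz]; field_simp; ring
  rw [harg, Complex.sin_add_pi_div_two, Complex.cos_mul_I, halfSech]
  push_cast
  rw [mul_inv]
  field_simp

lemma integral_halfSech_ofReal : ∫ t : ℝ, (halfSech t : ℂ) = π := by
  have h := integral_exp_mul_halfSech 0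
  simp only [Complex.ofReal_zero, zero_div, zero_mul, mul_zero, Complex.exp_zero, one_mul] at h
  rw [h, halfSech]
  simp
  ring

lemma integral_halfSech : ∫ t : ℝ, halfSech t = π := by
  have h := integral_halfSech_ofReal
  rw [integral_complex_ofReal] at h
  exact_mod_cast h

lemma integrable_halfSech : Integrable halfSech := by
  by_contra h
  exact Real.pi_ne_zero (integral_halfSech.symm.trans (integral_undef h))

lemma integrable_halfSech_pow (k : ℕ) : Integrable fun t => halfSech t ^ (k + 1) := by
  refine integrable_halfSech.mono' (continuous_halfSech.pow _).aestronglyMeasurable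
    (ae_of_all _ fun t => ?_)
  rw [Real.norm_of_nonneg (pow_nonneg (halfSech_pos t).le _), pow_succ]
  exact mul_le_of_le_one_left (halfSech_pos t).le
    (pow_le_one₀ (halfSech_pos t).le (halfSech_le_one t))

lemma integral_halfSech_sq : ∫ t : ℝ, halfSech t ^ 2 = 1 := by
  have h := integral_of_hasDerivAt_of_tendsto (f := Real.sigmoid) (f' := fun t => halfSech t ^ 2)
    (fun t => by rw [← sigmoid_mul_one_sub]; exact hasDerivAt_sigmoid t)
    (integrable_halfSech_pow 1) Real.tendsto_sigmoid_atBot Real.tendsto_sigmoid_atTop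
  simpa using h

lemma cosh_mul_halfSech (t : ℝ) : Real.cosh (t / 2) * halfSech t = 1 / 2 := by
  have := Real.cosh_pos (t / 2)
  rw [halfSech]
  field_simp

lemma hasDerivAt_halfSech (t : ℝ) :
    HasDerivAt halfSech (-(Real.sinh (t / 2) * halfSech t ^ 2)) t := by
  have hc := Real.cosh_pos (t / 2)
  have h := (((hasDerivAt_id t).div_const 2).cosh.const_mul 2).inv
    (mul_pos two_pos hc).ne'
  refine h.congr_deriv ?_
  simp only [id, halfSech]
  field_simp

lemma hasDerivAt_sinh_mul_halfSech_pow (k : ℕ) (t : ℝ) :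
    HasDerivAt (fun t => Real.sinh (t / 2) * halfSech t ^ (k + 2))
      ((k + 2) * halfSech t ^ (k + 3) - (k + 1) / 4 * halfSech t ^ (k + 1)) t := by
  have h := ((hasDerivAt_id t).div_const 2).sinh.mul ((hasDerivAt_halfSech t).pow (k + 2))
  refine h.congr_deriv ?_
  have h1 := cosh_mul_halfSech t
  have h2 := Real.cosh_sq (t / 2)
  simp only [id, Pi.pow_apply]
  push_cast
  have h3 : Real.sinh (t / 2) ^ 2 * halfSech t ^ 2 = 1 / 4 - halfSech t ^ 2 := by
    linear_combination (Real.cosh (t / 2) * halfSech t + 1 / 2) * h1 - halfSech t ^ 2 * h2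
  simp only [Nat.add_succ_sub_one, pow_succ] at *
  linear_combination (1 / 2 * halfSech t ^ k * halfSech t) * h1
    - ((k + 2) * halfSech t ^ k * halfSech t) * h3

lemma integral_halfSech_pow_add_two (k : ℕ) :
    ∫ t : ℝ, halfSech t ^ (k + 3) = (k + 1) / (4 * (k + 2)) * ∫ t : ℝ, halfSech t ^ (k + 1) := by
  have hi1 := (integrable_halfSech_pow (k + 2)).const_mul ((k : ℝ) + 2)
  have hi2 := (integrable_halfSech_pow k).const_mul (((k : ℝ) + 1) / 4)
  have hF : Integrable fun t => Real.sinh (t / 2) * halfSech t ^ (k + 2) := by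
    refine (integrable_halfSech_pow k).mono'
      (Continuous.aestronglyMeasurable ?_) (ae_of_all _ fun t => ?_)
    · have := continuous_halfSech
      fun_prop
    · have hg := halfSech_pos t
      rw [norm_mul, Real.norm_of_nonneg (pow_nonneg hg.le _), pow_succ, mul_left_comm,
        Real.norm_eq_abs, Real.abs_sinh]
      refine mul_le_of_le_one_right (by positivity) ?_
      have h1 := cosh_mul_halfSech t
      have h2 := Real.sinh_lt_cosh |t / 2|
      rw [Real.cosh_abs] at h2
      nlinarith
  have h := integral_eq_zero_of_hasDerivAt_of_integrable
    (hasDerivAt_sinh_mul_halfSech_pow k) (hi1.sub hi2) hF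
  rw [integral_sub hi1 hi2, integral_const_mul, integral_const_mul] at h
  have : (k : ℝ) + 2 ≠ 0 := by positivity
  field_simp
  linarith

lemma two_pi_pow_mul_integral_halfSech_even (j : ℕ) :
    (2 * π) ^ (2 * j) * ∫ t : ℝ, halfSech t ^ (2 * j + 2) =
      (Nat.doubleFactorial (2 * j) : ℝ) / Nat.doubleFactorial (2 * j + 1) * π ^ (2 * j) := by
  induction j with
  | zero => simp [integral_halfSech_sq]
  | succ j ih =>
    have h := integral_halfSech_pow_add_two (2 * j + 1)
    rw [show 2 * (j + 1) + 2 = 2 * j + 1 + 3 by ring, h, show 2 * (j + 1) = 2 * j + 2 by ring,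
      show 2 * j + 2 + 1 = 2 * j + 1 + 2 by ring, Nat.doubleFactorial_add_two,
      Nat.doubleFactorial_add_two, pow_add, pow_add]
    have h1 : (Nat.doubleFactorial (2 * j + 1) : ℝ) ≠ 0 := by
      exact_mod_cast (Nat.doubleFactorial_pos _).ne'
    push_cast at ih ⊢
    have h2 : (2 * (j : ℝ) + 1 + 2) ≠ 0 := by positivity
    calc _ = (2 * π) ^ 2 * ((2 * j + 1 + 1) / (4 * (2 * j + 1 + 2))) *
          ((2 * π) ^ (2 * j) * ∫ t : ℝ, halfSech t ^ (2 * j + 1 + 1)) := by ring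
      _ = _ := by
        rw [ih]
        field_simp
        ring

lemma two_pi_pow_mul_integral_halfSech_odd (j : ℕ) :
    (2 * π) ^ (2 * j + 1) * ∫ t : ℝ, halfSech t ^ (2 * j + 3) =
      (Nat.doubleFactorial (2 * j + 1) : ℝ) / (2 * Nat.doubleFactorial (2 * j + 2)) *
        π ^ (2 * j + 2) := by
  induction j with
  | zero =>
    have h := integral_halfSech_pow_add_two 0
    simp only [zero_add, pow_one, integral_halfSech] at h
    simp [h, Nat.doubleFactorial]
    ring
  | succ j ih =>
    have h := integral_halfSech_pow_add_two (2 * j + 2)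
    rw [show 2 * (j + 1) + 3 = 2 * j + 2 + 3 by ring, h,
      show 2 * (j + 1) + 1 = 2 * j + 1 + 2 by ring, show 2 * (j + 1) + 2 = 2 * j + 2 + 2 by ring,
      Nat.doubleFactorial_add_two, Nat.doubleFactorial_add_two (2 * j + 2),
      pow_add _ (2 * j + 1), pow_add _ (2 * j + 2)]
    have h1 : (Nat.doubleFactorial (2 * j + 2) : ℝ) ≠ 0 := by
      exact_mod_cast (Nat.doubleFactorial_pos _).ne'
    push_cast at ih ⊢
    have h2 : (2 * (j : ℝ) + 2 + 2) ≠ 0 := by positivity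
    calc _ = (2 * π) ^ 2 * ((2 * j + 2 + 1) / (4 * (2 * j + 2 + 2))) *
          ((2 * π) ^ (2 * j + 1) * ∫ t : ℝ, halfSech t ^ (2 * j + 2 + 1)) := by ring
      _ = _ := by
        rw [ih]
        field_simp
        ring

/-- The cyclic integral of `halfSech`, evaluated through its self-duality. -/
lemma two_pi_mul_integral_prod_halfSech (m : ℕ) :
    2 * π * ∫ s : Fin m → ℝ, (∏ i, halfSech (s i)) * halfSech (∑ i, s i) =
      (2 * π) ^ m * ∫ t : ℝ, halfSech t ^ (m + 1) := by
  have key : ∀ (s : Fin m → ℝ) (x : ℝ),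
      (∏ i, (halfSech (s i) : ℂ)) *
        (Complex.exp (x * ((∑ i, s i : ℝ) / (2 * π) * Complex.I)) * halfSech x) =
      halfSech x * ∏ i, (Complex.exp (s i * (x / (2 * π) * Complex.I)) * halfSech (s i)) := by
    intro s x
    rw [Finset.prod_mul_distrib, ← Complex.exp_sum, ← Finset.sum_mul]
    push_cast
    rw [show (x : ℂ) * ((∑ i, (s i : ℂ)) / (2 * π) * Complex.I) =
      (∑ i, (s i : ℂ)) * (x / (2 * π) * Complex.I) by ring]
    ring
  have hint : Integrable (Function.uncurry fun (s : Fin m → ℝ) (x : ℝ) =>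
      (∏ i, (halfSech (s i) : ℂ)) *
        (Complex.exp (x * ((∑ i, s i : ℝ) / (2 * π) * Complex.I)) * halfSech x))
      (volume.prod volume) := by
    have hg : Integrable (fun s : Fin m → ℝ => ∏ i, halfSech (s i)) :=
      Integrable.fintype_prod fun _ => integrable_halfSech
    refine (hg.mul_prod integrable_halfSech).mono' (Continuous.aestronglyMeasurable ?_)
      (ae_of_all _ fun p => le_of_eq ?_)
    · have := continuous_halfSech
      unfold Function.uncurry
      fun_prop
    · have hphase : (p.2 : ℂ) * ((∑ i, p.1 i : ℝ) / (2 * π) * Complex.I) =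
          ((p.2 * ((∑ i, p.1 i) / (2 * π)) : ℝ) : ℂ) * Complex.I := by
        push_cast; ring
      simp only [Function.uncurry]
      rw [hphase, norm_mul, norm_mul, Complex.norm_exp_ofReal_mul_I, norm_prod, one_mul]
      simp [abs_of_pos (halfSech_pos _)]
  have hswap := integral_integral_swap hint
  simp_rw [integral_const_mul, integral_exp_mul_halfSech, key, integral_const_mul] at hswap
  have hprod : ∀ x : ℝ, ∫ s : Fin m → ℝ,
      ∏ i, (Complex.exp (s i * (x / (2 * π) * Complex.I)) * (halfSech (s i) : ℂ)) =
        (2 * π * halfSech x) ^ m := fun x => by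
    rw [← integral_exp_mul_halfSech x]
    simpa using integral_fintype_prod_volume_eq_pow (ι := Fin m)
      (fun t : ℝ => Complex.exp (t * (x / (2 * π) * Complex.I)) * (halfSech t : ℂ))
  simp_rw [hprod] at hswap
  rw [← integral_const_mul, ← integral_const_mul, ← Complex.ofReal_inj,
    ← integral_complex_ofReal, ← integral_complex_ofReal]
  refine Eq.trans (integral_congr_ae (ae_of_all _ fun s => ?_))
    (hswap.trans (integral_congr_ae (ae_of_all _ fun x => ?_)))
  · push_cast; ring
  · push_cast; ring

lemma integrable_prod_mul_halfSech_sum (m : ℕ) :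
    Integrable fun s : Fin m → ℝ => (∏ i, halfSech (s i)) * halfSech (∑ i, s i) := by
  have hg : Integrable (fun s : Fin m → ℝ => ∏ i, halfSech (s i)) :=
    Integrable.fintype_prod fun _ => integrable_halfSech
  refine hg.mono' (Continuous.aestronglyMeasurable ?_) (ae_of_all _ fun s => ?_)
  · have := continuous_halfSech
    fun_prop
  · have hp : 0 ≤ ∏ i, halfSech (s i) := Finset.prod_nonneg fun i _ => (halfSech_pos _).le
    rw [Real.norm_of_nonneg (mul_nonneg hp (halfSech_pos _).le)]
    exact mul_le_of_le_one_right hp (halfSech_le_one _)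

lemma prod_mul_halfSech_sum (m : ℕ) (s : Fin m → ℝ) :
    (∏ i, halfSech (s i)) * halfSech (∑ i, s i) =
      1 / ((∏ i, (1 + Real.exp (-s i))) * (1 + Real.exp (∑ i, s i))) := by
  have h1 : (∏ i, halfSech (s i)) * Real.exp ((∑ i, s i) / 2) =
      (∏ i, (1 + Real.exp (-s i)))⁻¹ := by
    rw [Finset.sum_div, Real.exp_sum, ← Finset.prod_mul_distrib, ← Finset.prod_inv_distrib]
    exact Finset.prod_congr rfl fun i _ => halfSech_mul_exp _
  have h2 := halfSech_mul_exp (-∑ i, s i)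
  rw [halfSech_neg, neg_neg, neg_div] at h2
  have h3 : Real.exp ((∑ i, s i) / 2) * Real.exp (-((∑ i, s i) / 2)) = 1 := by
    rw [← Real.exp_add]; simp
  rw [one_div, mul_inv, ← h1, ← h2]
  linear_combination (-(∏ i, halfSech (s i)) * halfSech (∑ i, s i)) * h3

lemma sum_range_padR (m : ℕ) (s : Fin m → ℝ) :
    ∑ r ∈ Finset.range m, padR m s r = ∑ i, s i := by
  rw [Finset.sum_range]
  simp [padR]

/-- Keeping only the last exponential of the fan integrand makes the integral cyclic. -/
lemma integral_fan_le (m : ℕ) :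
    ∫ s : Fin (m + 1) → ℝ, 1 / ((∏ i, (1 + Real.exp (-s i))) *
        (1 + ∑ j ∈ Finset.Icc 1 (m + 1), Real.exp (∑ r ∈ Finset.range j, padR (m + 1) s r))) ≤
      (2 * π) ^ m * ∫ t : ℝ, halfSech t ^ (m + 2) := by
  have h := two_pi_mul_integral_prod_halfSech (m + 1)
  rw [pow_succ', mul_assoc (2 * π)] at h
  refine le_of_le_of_eq ?_ (mul_left_cancel₀ (mul_pos two_pos Real.pi_pos).ne' h)
  have hpos : ∀ s : Fin (m + 1) → ℝ, 0 < ∏ i, (1 + Real.exp (-s i)) := fun s =>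
    Finset.prod_pos fun i _ => by positivity
  refine integral_mono_of_nonneg (ae_of_all _ fun s => ?_)
    (integrable_prod_mul_halfSech_sum (m + 1)) (ae_of_all _ fun s => ?_)
  · have := hpos s
    simp only [Pi.zero_apply]
    positivity
  · have := hpos s
    simp only [prod_mul_halfSech_sum]
    gcongr
    rw [← sum_range_padR]
    exact Finset.single_le_sum
      (f := fun j => Real.exp (∑ r ∈ Finset.range j, padR (m + 1) s r))
      (fun j _ => (Real.exp_pos _).le) (by simp)

/-- Upper bound for the Mirzakhani volume `V_{𝔻ₙ}` of the moduli space of ideal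
`n`-gons: `V_{𝔻ₙ} ≤ ((n-4)‼/(n-3)‼) π^{n-4}` for `n` even, and
`V_{𝔻ₙ} ≤ ((n-4)‼/(2(n-3)‼)) π^{n-3}` for `n` odd. -/
theorem ngon_volume_upper_bound (n : ℕ) (hn : 4 ≤ n) :
    (Even n →
      (∫ s : Fin (n - 3) → ℝ,
          1 / ((∏ i, (1 + Real.exp (-s i))) *
            (1 + ∑ j ∈ Finset.Icc 1 (n - 3),
              Real.exp (∑ r ∈ Finset.range j, padR (n - 3) s r))))
        ≤ (Nat.doubleFactorial (n - 4) : ℝ) / (Nat.doubleFactorial (n - 3) : ℝ) *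
            Real.pi ^ (n - 4)) ∧
    (Odd n →
      (∫ s : Fin (n - 3) → ℝ,
          1 / ((∏ i, (1 + Real.exp (-s i))) *
            (1 + ∑ j ∈ Finset.Icc 1 (n - 3),
              Real.exp (∑ r ∈ Finset.range j, padR (n - 3) s r))))
        ≤ (Nat.doubleFactorial (n - 4) : ℝ) / (2 * (Nat.doubleFactorial (n - 3) : ℝ)) *
            Real.pi ^ (n - 3)) := by
  obtain ⟨m, rfl⟩ : ∃ m, n = m + 4 := ⟨n - 4, by omega⟩
  have h := integral_fan_le m
  simp only [show m + 4 - 3 = m + 1 by omega, show m + 4 - 4 = m by omega]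
  constructor
  · intro he
    obtain ⟨j, rfl⟩ : ∃ j, m = 2 * j := by
      obtain ⟨r, hr⟩ := he
      exact ⟨r - 2, by omega⟩
    exact h.trans_eq (two_pi_pow_mul_integral_halfSech_even j)
  · intro ho
    obtain ⟨j, rfl⟩ : ∃ j, m = 2 * j + 1 := by
      obtain ⟨r, hr⟩ := ho
      exact ⟨r - 2, by omega⟩
    exact h.trans_eq (two_pi_pow_mul_integral_halfSech_odd j)
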